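/- Let t, u ∈ ℂ with ‖t‖ < 1 and ‖u‖ < 1. Then the iterated normalized contour integral over |z| = 1, |w| = 1, |x₁| = 1 and |x₂| = 1, each against dμ_{SU(2)}, of PE_F[(z+1/z)(w+1/w); u] · PE_B[(z+1/z)(x₁+1/x₁)(x₂+1/x₂); t] · PE_B[(w+1/w)(x₁+1/x₁)(x₂+1/x₂); t] equals (1 − t²(u−1)²u − 2t⁴(u³ + u) − t⁶(u−1)²u + u⁴ + 2t⁸u²)/(1 − t⁴)⁴. This is the Hilbert–Poincaré series of (SO(4)×SO(4))-invariant form polynomials for the curved supercoset OSp(4|4)/(SO(4)×SO(4)). -/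

import Mathlib

/-- Normalized contour integral `(2πi)⁻¹ ∮_{|z|=1} f(z) dz` over the positively
oriented unit circle. -/
noncomputable def cint (f : ℂ → ℂ) : ℂ :=
  (2 * (Real.pi : ℂ) * Complex.I)⁻¹ * (∮ z in C(0, 1), f z)

/-- Normalized contour integral `∮ f(z) dz/(2πi z)`. -/
noncomputable def nint (f : ℂ → ℂ) : ℂ :=
  cint fun z => f z / z

/-- Bosonic plethystic exponential `PE_B[χ; t] = ∏_j (1 - t mⱼ)⁻¹`, for `χ` the
sum of the Laurent monomials `mⱼ` in the list `ms`. -/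
noncomputable def PE_B (t : ℂ) (ms : List ℂ) : ℂ :=
  ((ms.map fun m => 1 - t * m).prod)⁻¹

/-- Fermionic plethystic exponential `PE_F[χ; t] = ∏_j (1 - t mⱼ)`. -/
noncomputable def PE_F (t : ℂ) (ms : List ℂ) : ℂ :=
  (ms.map fun m => 1 - t * m).prod

open Real Metric in
theorem nint_eq_circleAverage (f : ℂ → ℂ) : nint f = circleAverage f 0 1 := by
  rw [circleAverage_eq_circleIntegral one_ne_zero]
  simp [nint, cint, div_eq_inv_mul, smul_eq_mul]

theorem nint_eq_intervalIntegral (f : ℂ → ℂ) :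
    nint f = (2 * Real.pi)⁻¹ • ∫ θ in 0..2 * Real.pi, f (Complex.exp (θ * Complex.I)) := by
  rw [nint_eq_circleAverage, Real.circleAverage_def]
  simp [circleMap]

theorem nint_congr {f g : ℂ → ℂ} (h : ∀ z, ‖z‖ = 1 → f z = g z) : nint f = nint g := by
  rw [nint_eq_intervalIntegral, nint_eq_intervalIntegral]
  congr 2
  ext θ
  exact h _ (Complex.norm_exp_ofReal_mul_I θ)

theorem nint_const_mul (c : ℂ) (f : ℂ → ℂ) : nint (fun z => c * f z) = c * nint f := by
  simp only [nint_eq_intervalIntegral, intervalIntegral.integral_const_mul,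
    mul_smul_comm]

theorem nint_eq_of_symmetrization {f N : ℂ → ℂ} (hf : ContinuousOn f (Metric.sphere 0 1))
    (hN : ∀ z, ‖z‖ ≤ 1 → DifferentiableAt ℂ N z)
    (h : ∀ z, ‖z‖ = 1 → f z + f z⁻¹ = N z + N z⁻¹) : nint f = N 0 := by
  have inv_sphere : Set.MapsTo (fun z : ℂ => z⁻¹) (Metric.sphere 0 1) (Metric.sphere 0 1) := by
    intro z hz
    simpa using hz
  have cont_inv : ContinuousOn (fun z : ℂ => z⁻¹) (Metric.sphere 0 1) :=
    continuousOn_inv₀.mono fun z hz => by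
      rintro rfl
      simp at hz
  have hNc : ContinuousOn N (Metric.sphere 0 1) := fun z hz =>
    (hN z (by simpa using hz.le)).continuousAt.continuousWithinAt
  have key : ∀ g : ℂ → ℂ, ContinuousOn g (Metric.sphere 0 1) →
      nint (fun z => g z + g z⁻¹) = 2 * nint g := by
    intro g hg
    simp only [nint_eq_circleAverage]
    have hgi : ContinuousOn (fun z => g z⁻¹) (Metric.sphere 0 1) := hg.comp cont_inv inv_sphere
    rw [Real.circleAverage_fun_add (hg.circleIntegrable zero_le_one)
      (hgi.circleIntegrable zero_le_one),
      Real.circleAverage_zero_one_congr_inv, two_mul]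
  have hN0 : nint N = N 0 := by
    rw [nint_eq_circleAverage]
    apply DiffContOnCl.circleAverage
    apply DifferentiableOn.diffContOnCl
    intro z hz
    refine (hN z ?_).differentiableWithinAt
    simpa using Metric.closure_ball_subset_closedBall hz
  have := key f hf
  rw [nint_congr h, key N hNc, hN0] at this
  exact (mul_left_cancel₀ two_ne_zero this).symm

theorem intervalIntegral_swap_of_continuous {F : ℝ → ℝ → ℂ} (hF : Continuous F.uncurry)
    (a b c d : ℝ) :
    ∫ x in a..b, ∫ y in c..d, F x y = ∫ y in c..d, ∫ x in a..b, F x y := by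
  apply MeasureTheory.intervalIntegral_intervalIntegral_swap
  exact (hF.continuousOn.integrableOn_compact (isCompact_uIcc.prod isCompact_uIcc)).mono_set
    (Set.prod_mono Set.uIoc_subset_uIcc Set.uIoc_subset_uIcc)

theorem nint_fubini {F : ℂ → ℂ → ℂ → ℂ → ℂ}
    (hF : Continuous fun p : ℝ × ℝ × ℝ × ℝ =>
      F (Complex.exp (p.1 * Complex.I)) (Complex.exp (p.2.1 * Complex.I))
        (Complex.exp (p.2.2.1 * Complex.I)) (Complex.exp (p.2.2.2 * Complex.I))) :
    (nint fun z => nint fun w => nint fun x => nint fun y => F z w x y) =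
      nint fun x => nint fun y => nint fun z => nint fun w => F z w x y := by
  simp only [nint_eq_intervalIntegral, intervalIntegral.integral_smul]
  congr 4
  generalize hG : (fun a b c d : ℝ => F (Complex.exp (a * Complex.I)) (Complex.exp (b * Complex.I))
    (Complex.exp (c * Complex.I)) (Complex.exp (d * Complex.I))) = G
  have e : ∀ a b c d : ℝ, F (Complex.exp (a * Complex.I)) (Complex.exp (b * Complex.I))
    (Complex.exp (c * Complex.I)) (Complex.exp (d * Complex.I)) = G a b c d := by
    simp [← hG]
  simp only [e] at hF ⊢
  have hcomp : ∀ {X : Type} [TopologicalSpace X] {a b c d : X → ℝ}, Continuous a → Continuous b →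
      Continuous c → Continuous d → Continuous fun x => G (a x) (b x) (c x) (d x) :=
    fun ha hb hc hd => hF.comp (ha.prodMk (hb.prodMk (hc.prodMk hd)))
  have swap_wx (z : ℝ) := intervalIntegral_swap_of_continuous
    (F := fun w x => ∫ y in 0..2 * Real.pi, G z w x y)
    (intervalIntegral.continuous_parametric_intervalIntegral_of_continuous'
      (by apply hcomp <;> fun_prop) _ _) 0 (2 * Real.pi) 0 (2 * Real.pi)
  have swap_wy (z x : ℝ) := intervalIntegral_swap_of_continuous
    (F := fun w y => G z w x y)
    (by apply hcomp <;> fun_prop) 0 (2 * Real.pi) 0 (2 * Real.pi)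
  have cont_w : Continuous fun p : (ℝ × ℝ) × ℝ => ∫ w in 0..2 * Real.pi, G p.1.1 w p.1.2 p.2 :=
    intervalIntegral.continuous_parametric_intervalIntegral_of_continuous'
      (by apply hcomp <;> fun_prop) _ _
  have swap_zx := intervalIntegral_swap_of_continuous
    (F := fun z x => ∫ y in 0..2 * Real.pi, ∫ w in 0..2 * Real.pi, G z w x y)
    (intervalIntegral.continuous_parametric_intervalIntegral_of_continuous' cont_w _ _)
    0 (2 * Real.pi) 0 (2 * Real.pi)
  have swap_zy (x : ℝ) := intervalIntegral_swap_of_continuous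
    (F := fun z y => ∫ w in 0..2 * Real.pi, G z w x y)
    (cont_w.comp (f := fun p : ℝ × ℝ => ((p.1, x), p.2)) (by fun_prop))
    0 (2 * Real.pi) 0 (2 * Real.pi)
  simp only [swap_wx, swap_wy, swap_zx, swap_zy]

theorem one_sub_mul_ne_zero {t m : ℂ} (ht : ‖t‖ < 1) (hm : ‖m‖ ≤ 1) : 1 - t * m ≠ 0 := by
  intro h
  have := congrArg norm (sub_eq_zero.mp h)
  rw [norm_one, norm_mul] at this
  nlinarith [norm_nonneg t, norm_nonneg m]

theorem mul_div_add_mul_div_eq {K : Type*} [Field K] {a b k p q r s m n : K} (ha : a ≠ 0)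
    (hb : b ≠ 0) (hk : k ≠ 0) (h : (p * q + r * s) * k = m * b + n * a) :
    p * (q / (a * b)) + r * (s / (b * a)) = m / (k * a) + n / (k * b) := by
  field_simp
  linear_combination h

theorem norm_sq_lt_one {t : ℂ} (ht : ‖t‖ < 1) : ‖t ^ 2‖ < 1 := by
  rw [norm_pow]
  exact pow_lt_one₀ (norm_nonneg t) ht two_ne_zero

theorem one_sub_sq_ne_zero {t : ℂ} (ht : ‖t‖ < 1) : 1 - t ^ 2 ≠ 0 := by
  simpa using one_sub_mul_ne_zero (norm_sq_lt_one ht) (m := 1) (by simp)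

theorem one_add_sq_ne_zero {t : ℂ} (ht : ‖t‖ < 1) : 1 + t ^ 2 ≠ 0 := by
  simpa using one_sub_mul_ne_zero (norm_sq_lt_one ht) (m := -1) (by simp)

/-- The factor `(1 - t²x²)(1 - t²x⁻²)`, written through `x + x⁻¹`. -/
noncomputable def quadFactor (t x : ℂ) : ℂ := (1 + t ^ 2) ^ 2 - t ^ 2 * (x + 1 / x) ^ 2

theorem quadFactor_eq (t : ℂ) {x : ℂ} (hx : x ≠ 0) :
    quadFactor t x = (1 - t ^ 2 * x ^ 2) * (1 - t ^ 2 * (x⁻¹) ^ 2) := by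
  unfold quadFactor
  field_simp
  ring

theorem quadFactor_ne_zero {t x : ℂ} (ht : ‖t‖ < 1) (hx : ‖x‖ = 1) : quadFactor t x ≠ 0 := by
  rw [quadFactor_eq t (by rintro rfl; simp at hx)]
  exact mul_ne_zero (one_sub_mul_ne_zero (norm_sq_lt_one ht) (by simp [hx]))
    (one_sub_mul_ne_zero (norm_sq_lt_one ht) (by simp [hx]))

theorem nint_quadFactor {t : ℂ} (ht : ‖t‖ < 1) (α β : ℂ) :
    (nint fun x => (1 - x ^ 2) * ((α + β * (x + 1 / x) ^ 2) / quadFactor t x ^ 2)) =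
      (α + β * (1 + t ^ 2) ^ 2) / ((1 - t ^ 2) * (1 + t ^ 2) ^ 3) := by
  have h1 : 1 - t ^ 2 ≠ 0 := one_sub_sq_ne_zero ht
  have h2 : 1 + t ^ 2 ≠ 0 := one_add_sq_ne_zero ht
  have hne : ∀ x : ℂ, ‖x‖ ≤ 1 → 1 - t ^ 2 * x ^ 2 ≠ 0 := fun x hx =>
    one_sub_mul_ne_zero (norm_sq_lt_one ht) (by rw [norm_pow]; exact pow_le_one₀ (norm_nonneg x) hx)
  rw [nint_eq_of_symmetrization (N := fun x =>
    (α * (1 - (1 - t ^ 2) * (1 + t ^ 2) * x ^ 2 - t ^ 4 * x ^ 4)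
        + β * (1 + t ^ 2) ^ 2 * (1 - x ^ 4)) /
      ((1 - t ^ 2) * (1 + t ^ 2) ^ 3 * (1 - t ^ 2 * x ^ 2) ^ 2))]
  · simp
  · intro x hx
    have hx1 : ‖x‖ = 1 := by simpa using hx
    have hx0 : x ≠ 0 := by rintro rfl; simp at hx1
    have hq : (1 + t ^ 2) ^ 2 - t ^ 2 * (x + 1 / x) ^ 2 ≠ 0 := quadFactor_ne_zero ht hx1
    apply ContinuousAt.continuousWithinAt
    unfold quadFactor
    fun_prop (disch := first | assumption | exact pow_ne_zero _ hq)
  · intro x hx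
    have := hne x hx
    have hd : (1 - t ^ 2) * (1 + t ^ 2) ^ 3 * (1 - t ^ 2 * x ^ 2) ^ 2 ≠ 0 := by positivity
    fun_prop (disch := assumption)
  · intro x hx
    have hx0 : x ≠ 0 := by rintro rfl; simp at hx
    have e1 := hne x hx.le
    have e2 := hne x⁻¹ (by simp [hx])
    rw [quadFactor_eq t hx0, quadFactor_eq t (inv_ne_zero hx0), inv_inv]
    generalize ha : 1 - t ^ 2 * x ^ 2 = a at *
    generalize hb : 1 - t ^ 2 * x⁻¹ ^ 2 = b at *
    have hk : (1 - t ^ 2) * (1 + t ^ 2) ^ 3 ≠ 0 := mul_ne_zero h1 (pow_ne_zero 3 h2)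
    have expand : ((1 - x ^ 2) * (α + β * (x + 1 / x) ^ 2)
          + (1 - x⁻¹ ^ 2) * (α + β * (x⁻¹ + 1 / x⁻¹) ^ 2)) * ((1 - t ^ 2) * (1 + t ^ 2) ^ 3) =
        (α * (1 - (1 - t ^ 2) * (1 + t ^ 2) * x ^ 2 - t ^ 4 * x ^ 4)
            + β * (1 + t ^ 2) ^ 2 * (1 - x ^ 4)) * b ^ 2 +
          (α * (1 - (1 - t ^ 2) * (1 + t ^ 2) * x⁻¹ ^ 2 - t ^ 4 * x⁻¹ ^ 4)
            + β * (1 + t ^ 2) ^ 2 * (1 - x⁻¹ ^ 4)) * a ^ 2 := by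
      rw [← ha, ← hb]
      field_simp
      ring
    simp only [mul_pow]
    exact mul_div_add_mul_div_eq (pow_ne_zero 2 e1) (pow_ne_zero 2 e2) hk expand

/-- The quartic `∏ (1 - t z xᵃ yᵇ)` over the signs `a, b = ±1`. -/
noncomputable def bidoubletPoly (t x y z : ℂ) : ℂ :=
  (1 - t * (z * x * y)) * (1 - t * (z * x / y)) * (1 - t * (z * y / x)) * (1 - t * (z / (x * y)))

theorem bidoubletPoly_eq (t z : ℂ) {x y : ℂ} (hx : x ≠ 0) (hy : y ≠ 0) :
    bidoubletPoly t x y z =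
      1 - t * ((x + 1 / x) * (y + 1 / y)) * z
        + t ^ 2 * ((x + 1 / x) ^ 2 + (y + 1 / y) ^ 2 - 2) * z ^ 2
        - t ^ 3 * ((x + 1 / x) * (y + 1 / y)) * z ^ 3 + t ^ 4 * z ^ 4 := by
  unfold bidoubletPoly
  field_simp
  ring

theorem bidoubletPoly_ne_zero {t x y z : ℂ} (ht : ‖t‖ < 1) (hx : ‖x‖ = 1) (hy : ‖y‖ = 1)
    (hz : ‖z‖ ≤ 1) : bidoubletPoly t x y z ≠ 0 := by
  unfold bidoubletPoly
  refine mul_ne_zero (mul_ne_zero (mul_ne_zero ?_ ?_) ?_) ?_ <;>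
    exact one_sub_mul_ne_zero ht (by simpa [hx, hy] using hz)

theorem PE_B_bidoublet (t : ℂ) {x y z : ℂ} (hx : x ≠ 0) (hy : y ≠ 0) (hz : z ≠ 0) :
    PE_B t [z * x * y, z * x / y, z * y / x, z / (x * y),
        x * y / z, x / (z * y), y / (z * x), 1 / (z * x * y)] =
      (bidoubletPoly t x y z * bidoubletPoly t x y z⁻¹)⁻¹ := by
  simp only [PE_B, bidoubletPoly, List.map_cons, List.map_nil, List.prod_cons, List.prod_nil]
  congr 1
  field_simp

theorem PE_F_bidoublet (u : ℂ) {z w : ℂ} (hz : z ≠ 0) (hw : w ≠ 0) :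
    PE_F u [z * w, z / w, w / z, 1 / (z * w)] =
      (1 - u ^ 2) ^ 2 + u ^ 2 * (w + 1 / w) ^ 2 + -(u + u ^ 3) * (w + 1 / w) * (z + 1 / z)
        + u ^ 2 * (z + 1 / z) ^ 2 := by
  simp only [PE_F, List.map_cons, List.map_nil, List.prod_cons, List.prod_nil]
  field_simp
  ring

theorem nint_bidoublet {t x y : ℂ} (ht : ‖t‖ < 1) (hx : ‖x‖ = 1) (hy : ‖y‖ = 1) (α β γ : ℂ) :
    (nint fun z => (1 - z ^ 2) * ((α + β * (z + 1 / z) + γ * (z + 1 / z) ^ 2) /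
        (bidoubletPoly t x y z * bidoubletPoly t x y z⁻¹))) =
      (α * (1 + t ^ 2) + β * (t * ((x + 1 / x) * (y + 1 / y)))
        + γ * ((1 + t ^ 2) ^ 3 - t ^ 2 * (1 + t ^ 2) * ((x + 1 / x) ^ 2 + (y + 1 / y) ^ 2)
          + t ^ 2 * ((x + 1 / x) * (y + 1 / y)) ^ 2)) /
        ((1 - t ^ 2) * (quadFactor t x * quadFactor t y)) := by
  have h1 : 1 - t ^ 2 ≠ 0 := one_sub_sq_ne_zero ht
  have hx0 : x ≠ 0 := by rintro rfl; simp at hx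
  have hy0 : y ≠ 0 := by rintro rfl; simp at hy
  have hk : (1 - t ^ 2) * (quadFactor t x * quadFactor t y) ≠ 0 :=
    mul_ne_zero h1 (mul_ne_zero (quadFactor_ne_zero ht hx) (quadFactor_ne_zero ht hy))
  have hne : ∀ z : ℂ, ‖z‖ ≤ 1 → bidoubletPoly t x y z ≠ 0 := fun z hz =>
    bidoubletPoly_ne_zero ht hx hy hz
  simp only [bidoubletPoly_eq t _ hx0 hy0] at hne ⊢
  unfold quadFactor at hk ⊢
  generalize x + 1 / x = X at *
  generalize y + 1 / y = Y at *
  rw [nint_eq_of_symmetrization (N := fun z =>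
    (α * ((1 + t ^ 2) - t ^ 3 * (X * Y) * z - (1 - t ^ 2) * (1 + t ^ 2) ^ 2 * z ^ 2
          + t ^ 3 * (X * Y) * z ^ 3 - t ^ 4 * (1 + t ^ 2) * z ^ 4)
      + β * (t * (X * Y) + (1 + t ^ 2) * ((1 + t ^ 2) ^ 2 - t ^ 2 * (X ^ 2 + Y ^ 2)) * z
          - t * (1 - t ^ 2) * (1 + t ^ 2) * (X * Y) * z ^ 2
          - (1 + t ^ 2) * ((1 + t ^ 2) ^ 2 - t ^ 2 * (X ^ 2 + Y ^ 2)) * z ^ 3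
          - t ^ 5 * (X * Y) * z ^ 4)
      + γ * (((1 + t ^ 2) ^ 3 - t ^ 2 * (1 + t ^ 2) * (X ^ 2 + Y ^ 2) + t ^ 2 * (X * Y) ^ 2)
          + t * (X * Y) * ((1 + t ^ 2) ^ 2 - t ^ 2 * (X ^ 2 + Y ^ 2)) * z
          - t ^ 2 * (1 - t ^ 2) * (X * Y) ^ 2 * z ^ 2
          - t * (X * Y) * ((1 + t ^ 2) ^ 2 - t ^ 2 * (X ^ 2 + Y ^ 2)) * z ^ 3
          - ((1 + t ^ 2) ^ 3 - t ^ 2 * (1 + t ^ 2) * (X ^ 2 + Y ^ 2)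
            + t ^ 4 * (X * Y) ^ 2) * z ^ 4)) /
      ((1 - t ^ 2) * (((1 + t ^ 2) ^ 2 - t ^ 2 * X ^ 2) * ((1 + t ^ 2) ^ 2 - t ^ 2 * Y ^ 2)) *
        (1 - t * (X * Y) * z + t ^ 2 * (X ^ 2 + Y ^ 2 - 2) * z ^ 2 - t ^ 3 * (X * Y) * z ^ 3
          + t ^ 4 * z ^ 4)))]
  · simp
  · intro z hz
    have hz1 : ‖z‖ = 1 := by simpa using hz
    have hz0 : z ≠ 0 := by rintro rfl; simp at hz1
    have hd := mul_ne_zero (hne z hz1.le) (hne z⁻¹ (by simp [hz1]))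
    apply ContinuousAt.continuousWithinAt
    fun_prop (disch := assumption)
  · intro z hz
    have hd := mul_ne_zero hk (hne z hz)
    fun_prop (disch := assumption)
  · intro z hz
    have hz0 : z ≠ 0 := by rintro rfl; simp at hz
    have e1 := hne z hz.le
    have e2 := hne z⁻¹ (by simp [hz])
    simp only [inv_inv]
    refine mul_div_add_mul_div_eq e1 e2 hk ?_
    field_simp
    ring

/-- The integrand of the Hilbert–Poincaré series, with the four Weyl measure factors included. -/
noncomputable def integrand (t u z w x₁ x₂ : ℂ) : ℂ :=
  (1 - z ^ 2) * ((1 - w ^ 2) * ((1 - x₁ ^ 2) * ((1 - x₂ ^ 2) *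
    (PE_F u [z * w, z / w, w / z, 1 / (z * w)] *
      PE_B t [z * x₁ * x₂, z * x₁ / x₂, z * x₂ / x₁, z / (x₁ * x₂),
              x₁ * x₂ / z, x₁ / (z * x₂), x₂ / (z * x₁), 1 / (z * x₁ * x₂)] *
      PE_B t [w * x₁ * x₂, w * x₁ / x₂, w * x₂ / x₁, w / (x₁ * x₂),
              x₁ * x₂ / w, x₁ / (w * x₂), x₂ / (w * x₁), 1 / (w * x₁ * x₂)]))))

theorem continuous_integrand {X : Type*} [TopologicalSpace X] {t : ℂ} (u : ℂ) (ht : ‖t‖ < 1)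
    {z w x₁ x₂ : X → ℂ} (cz : Continuous z) (cw : Continuous w) (cx₁ : Continuous x₁)
    (cx₂ : Continuous x₂) (hz : ∀ p, ‖z p‖ = 1) (hw : ∀ p, ‖w p‖ = 1) (hx₁ : ∀ p, ‖x₁ p‖ = 1)
    (hx₂ : ∀ p, ‖x₂ p‖ = 1) : Continuous fun p => integrand t u (z p) (w p) (x₁ p) (x₂ p) := by
  have ne_zero : ∀ {f : X → ℂ}, (∀ p, ‖f p‖ = 1) → ∀ p, f p ≠ 0 := by
    intro f hf p h
    simpa [h] using hf p
  have hne : ∀ {m : ℂ}, ‖m‖ = 1 → 1 - t * m ≠ 0 := fun hm => one_sub_mul_ne_zero ht hm.le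
  have z_ne := ne_zero hz
  have w_ne := ne_zero hw
  have x₁_ne := ne_zero hx₁
  have x₂_ne := ne_zero hx₂
  simp only [integrand, PE_B, PE_F, List.map_cons, List.map_nil, List.prod_cons, List.prod_nil,
    mul_one]
  refine (by fun_prop : Continuous fun p => 1 - z p ^ 2).mul
    ((by fun_prop : Continuous fun p => 1 - w p ^ 2).mul
    ((by fun_prop : Continuous fun p => 1 - x₁ p ^ 2).mul
    ((by fun_prop : Continuous fun p => 1 - x₂ p ^ 2).mul
    ((Continuous.mul ?_ (Continuous.inv₀ ?_ fun p => ?_)).mul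
      (Continuous.inv₀ ?_ fun p => ?_)))))
  · fun_prop (disch := simp [z_ne, w_ne])
  · fun_prop (disch := simp [z_ne, x₁_ne, x₂_ne])
  · simp only [mul_ne_zero_iff]
    refine ⟨?_, ?_, ?_, ?_, ?_, ?_, ?_, ?_⟩ <;> exact hne (by simp [hz, hx₁, hx₂])
  · fun_prop (disch := simp [w_ne, x₁_ne, x₂_ne])
  · simp only [mul_ne_zero_iff]
    refine ⟨?_, ?_, ?_, ?_, ?_, ?_, ?_, ?_⟩ <;> exact hne (by simp [hw, hx₁, hx₂])

theorem nint_nint_integrand {t x₁ x₂ : ℂ} (u : ℂ) (ht : ‖t‖ < 1) (hx₁ : ‖x₁‖ = 1)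
    (hx₂ : ‖x₂‖ = 1) :
    (nint fun z => nint fun w => integrand t u z w x₁ x₂) =
      (1 - x₁ ^ 2) * ((1 - x₂ ^ 2) *
        ((((((1 - u ^ 2) ^ 2 * (1 + t ^ 2) ^ 2 + 2 * u ^ 2 * (1 + t ^ 2) ^ 4)
            - 2 * u ^ 2 * t ^ 2 * (1 + t ^ 2) ^ 2 * (x₁ + 1 / x₁) ^ 2) /
              ((1 - t ^ 2) ^ 2 * quadFactor t x₁ ^ 2)) +
          ((-(2 * u ^ 2 * t ^ 2 * (1 + t ^ 2) ^ 2)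
            + (2 * u ^ 2 * t ^ 2 * (1 + t ^ 2) - (u + u ^ 3) * t ^ 2) * (x₁ + 1 / x₁) ^ 2) /
              ((1 - t ^ 2) ^ 2 * quadFactor t x₁ ^ 2)) * (x₂ + 1 / x₂) ^ 2) /
          quadFactor t x₂ ^ 2)) := by
  have h1 : 1 - t ^ 2 ≠ 0 := one_sub_sq_ne_zero ht
  have h2 : 1 + t ^ 2 ≠ 0 := one_add_sq_ne_zero ht
  have ne_zero : ∀ {z : ℂ}, ‖z‖ = 1 → z ≠ 0 := by
    rintro z hz rfl
    simp at hz
  have q₁ := quadFactor_ne_zero ht hx₁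
  have q₂ := quadFactor_ne_zero ht hx₂
  set K := (1 - t ^ 2) * (quadFactor t x₁ * quadFactor t x₂) with hK
  have hK0 : K ≠ 0 := mul_ne_zero h1 (mul_ne_zero q₁ q₂)
  set P := (x₁ + 1 / x₁) * (x₂ + 1 / x₂) with hP
  set g := (1 + t ^ 2) ^ 3 - t ^ 2 * (1 + t ^ 2) * ((x₁ + 1 / x₁) ^ 2 + (x₂ + 1 / x₂) ^ 2)
    + t ^ 2 * P ^ 2 with hg
  have w_integral : ∀ z : ℂ, ‖z‖ = 1 →
      (nint fun w => integrand t u z w x₁ x₂) =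
      (1 - x₁ ^ 2) * (1 - x₂ ^ 2) * K⁻¹ * ((1 - z ^ 2) *
        ((((1 - u ^ 2) ^ 2 * (1 + t ^ 2) + u ^ 2 * g) + -(u + u ^ 3) * (t * P) * (z + 1 / z)
          + u ^ 2 * (1 + t ^ 2) * (z + 1 / z) ^ 2) /
          (bidoubletPoly t x₁ x₂ z * bidoubletPoly t x₁ x₂ z⁻¹))) := by
    intro z hz
    have hw := nint_bidoublet ht hx₁ hx₂ ((1 - u ^ 2) ^ 2 + u ^ 2 * (z + 1 / z) ^ 2)
      (-(u + u ^ 3) * (z + 1 / z)) (u ^ 2)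
    rw [← hK, ← hP, ← hg] at hw
    rw [nint_congr (g := fun w => (1 - x₁ ^ 2) * (1 - x₂ ^ 2) * ((1 - z ^ 2) *
      (bidoubletPoly t x₁ x₂ z * bidoubletPoly t x₁ x₂ z⁻¹)⁻¹) * ((1 - w ^ 2) *
        (((1 - u ^ 2) ^ 2 + u ^ 2 * (z + 1 / z) ^ 2 + -(u + u ^ 3) * (z + 1 / z) * (w + 1 / w)
          + u ^ 2 * (w + 1 / w) ^ 2) /
          (bidoubletPoly t x₁ x₂ w * bidoubletPoly t x₁ x₂ w⁻¹))))]
    · rw [nint_const_mul, hw]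
      simp only [div_eq_mul_inv]
      ring
    · intro w hw
      rw [integrand, PE_F_bidoublet u (ne_zero hz) (ne_zero hw),
        PE_B_bidoublet t (ne_zero hx₁) (ne_zero hx₂) (ne_zero hz),
        PE_B_bidoublet t (ne_zero hx₁) (ne_zero hx₂) (ne_zero hw)]
      simp only [div_eq_mul_inv]
      ring
  have hz := nint_bidoublet ht hx₁ hx₂ ((1 - u ^ 2) ^ 2 * (1 + t ^ 2) + u ^ 2 * g)
      (-(u + u ^ 3) * (t * P)) (u ^ 2 * (1 + t ^ 2))
  rw [← hK, ← hP, ← hg] at hz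
  rw [nint_congr w_integral, nint_const_mul, hz, hK, hg, hP]
  generalize quadFactor t x₁ = Q₁ at *
  generalize quadFactor t x₂ = Q₂ at *
  generalize x₁ + 1 / x₁ = X₁ at *
  generalize x₂ + 1 / x₂ = X₂ at *
  field_simp
  ring

/-- Hilbert–Poincaré series of `(SO(4)×SO(4))`-invariant form polynomials for
the curved supercoset `OSp(4|4)/(SO(4)×SO(4))`. -/
theorem statement_7 (t u : ℂ) (ht : ‖t‖ < 1) (hu : ‖u‖ < 1) :
    (nint fun z => (1 - z ^ 2) *
      nint fun w => (1 - w ^ 2) *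
        nint fun x₁ => (1 - x₁ ^ 2) *
          nint fun x₂ => (1 - x₂ ^ 2) *
            (PE_F u [z * w, z / w, w / z, 1 / (z * w)] *
             PE_B t [z * x₁ * x₂, z * x₁ / x₂, z * x₂ / x₁, z / (x₁ * x₂),
                     x₁ * x₂ / z, x₁ / (z * x₂), x₂ / (z * x₁), 1 / (z * x₁ * x₂)] *
             PE_B t [w * x₁ * x₂, w * x₁ / x₂, w * x₂ / x₁, w / (x₁ * x₂),
                     x₁ * x₂ / w, x₁ / (w * x₂), x₂ / (w * x₁), 1 / (w * x₁ * x₂)]))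
      = (1 - t ^ 2 * (u - 1) ^ 2 * u - 2 * t ^ 4 * (u ^ 3 + u)
          - t ^ 6 * (u - 1) ^ 2 * u + u ^ 4 + 2 * t ^ 8 * u ^ 2) / (1 - t ^ 4) ^ 4 := by
  have h1 : 1 - t ^ 2 ≠ 0 := one_sub_sq_ne_zero ht
  have h2 : 1 + t ^ 2 ≠ 0 := one_add_sq_ne_zero ht
  simp only [← nint_const_mul]
  change (nint fun z => nint fun w => nint fun x₁ => nint fun x₂ => integrand t u z w x₁ x₂) = _
  rw [nint_fubini]
  · have x₂_integral : ∀ x₁ : ℂ, ‖x₁‖ = 1 → _ := fun x₁ hx₁ =>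
      (nint_congr fun x₂ hx₂ => nint_nint_integrand u ht hx₁ hx₂).trans
        ((nint_const_mul _ _).trans (congrArg _ (nint_quadFactor ht _ _)))
    rw [nint_congr x₂_integral, nint_congr (g := fun x => (1 - x ^ 2) *
      ((((1 - u ^ 2) ^ 2 * (1 + t ^ 2) ^ 2 + 2 * u ^ 2 * (1 + t ^ 2) ^ 4
          - 2 * u ^ 2 * t ^ 2 * (1 + t ^ 2) ^ 4) /
          ((1 - t ^ 2) ^ 3 * (1 + t ^ 2) ^ 3) +
        (-(2 * u ^ 2 * t ^ 2 * (1 + t ^ 2) ^ 2)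
          + (2 * u ^ 2 * t ^ 2 * (1 + t ^ 2) - (u + u ^ 3) * t ^ 2) * (1 + t ^ 2) ^ 2) /
          ((1 - t ^ 2) ^ 3 * (1 + t ^ 2) ^ 3) * (x + 1 / x) ^ 2) / quadFactor t x ^ 2)),
      nint_quadFactor ht]
    · have h4 : 1 - t ^ 4 = (1 - t ^ 2) * (1 + t ^ 2) := by ring
      rw [h4]
      field_simp
      ring
    · intro x hx
      have := quadFactor_ne_zero ht hx
      generalize quadFactor t x = Q at *
      generalize x + 1 / x = X at *
      field_simp
      ring
  · apply continuous_integrand u ht <;>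
      first
        | fun_prop
        | exact fun p => Complex.norm_exp_ofReal_mul_I _
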